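/- Let (U_i, 𝔅_i), i = 1,…,N, be measurable spaces whose σ-algebras contain all singletons, and let A, B : U = U_1 × ⋯ × U_N → ℝ be measurable functions such that A and B are integrable with respect to every product μ_1 × ⋯ × μ_N of probability measures μ_i on U_i and B is strictly of constant sign on U. If the test function C(u) = A(u)/B(u) is bounded above on U but does not attain its supremum, then for every ε > 0 there exists a point u(ε) = (u_1(ε),…,u_N(ε)) ∈ U with sup_{u ∈ U} C(u) − ε < C(u(ε)) < sup_{u ∈ U} C(u) < ∞, and the family of degenerate (Dirac) measures (δ_{u_1(ε)},…,δ_{u_N(ε)}) is ε-optimal: sup_{u ∈ U} C(u) − ε < I(δ_{u_1(ε)},…,δ_{u_N(ε)}) < sup_{u ∈ U} C(u), while I(μ_1,…,μ_N) < sup_{u ∈ U} C(u) for every family (μ_1,…,μ_N) of probability measures. -/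

import Mathlib

open MeasureTheory

/-- A ratio of integrals against a probability measure, with a denominator of constant sign, is
strictly below any strict pointwise upper bound of the ratio of the integrands. -/
theorem integral_div_integral_lt {Ω : Type*} [MeasurableSpace Ω] {μ : Measure Ω}
    [IsProbabilityMeasure μ] {f g : Ω → ℝ} {c : ℝ} (hf : Integrable f μ) (hg : Integrable g μ)
    (hsign : (∀ x, 0 < g x) ∨ (∀ x, g x < 0)) (h : ∀ x, f x / g x < c) :
    (∫ x, f x ∂μ) / (∫ x, g x ∂μ) < c := by
  have pos {k : Ω → ℝ} (hk : Integrable k μ) (hpos : ∀ x, 0 < k x) : 0 < ∫ x, k x ∂μ := by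
    rw [integral_pos_iff_support_of_nonneg (fun x => (hpos x).le) hk]
    have : Function.support k = Set.univ := Set.eq_univ_of_forall fun x => (hpos x).ne'
    simp [this]
  rcases hsign with hg_pos | hg_neg
  · have hlt := pos ((hg.const_mul c).sub hf) fun x =>
      sub_pos.2 ((div_lt_iff₀ (hg_pos x)).1 (h x))
    simp only [Pi.sub_apply] at hlt
    rw [integral_sub (hg.const_mul c) hf, integral_const_mul] at hlt
    exact (div_lt_iff₀ (pos hg hg_pos)).2 (sub_pos.1 hlt)
  · have hlt := pos (hf.sub (hg.const_mul c)) fun x =>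
      sub_pos.2 ((div_lt_iff_of_neg (hg_neg x)).1 (h x))
    simp only [Pi.sub_apply] at hlt
    rw [integral_sub hf (hg.const_mul c), integral_const_mul] at hlt
    have hneg : ∫ x, g x ∂μ < 0 := by
      simpa [integral_neg] using pos hg.neg fun x => neg_pos.2 (hg_neg x)
    exact (div_lt_iff_of_neg hneg).2 (sub_pos.1 hlt)

/-- The product of Dirac measures is the Dirac measure at the corresponding point. -/
theorem pi_dirac_eq_dirac {ι : Type*} [Fintype ι] {X : ι → Type*} [∀ i, MeasurableSpace (X i)]
    (x : ∀ i, X i) : Measure.pi (fun i => Measure.dirac (x i)) = Measure.dirac x := by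
  refine Measure.pi_eq fun s hs => ?_
  classical
  rw [Measure.dirac_apply' _ (MeasurableSet.univ_pi hs)]
  simp_rw [Measure.dirac_apply' _ (hs _), Set.indicator_apply, Pi.one_apply, Finset.prod_ite_zero]
  simp

/-- If the test function `C = A/B` is bounded above on `U` but does not attain its supremum,
then for every `ε > 0` there is a point `u(ε) ∈ U` whose test-function value lies within `ε`
of the supremum, the corresponding family of Dirac measures is `ε`-optimal for the
linear-fractional integral functional, and every family of probability measures gives a value
strictly below the supremum. -/
theorem stmt_7 {N : ℕ} {U : Fin N → Type*} [∀ i, MeasurableSpace (U i)]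
    [∀ i, MeasurableSingletonClass (U i)] [∀ i, Nonempty (U i)]
    (A B : ((i : Fin N) → U i) → ℝ)
    (hAm : Measurable A) (hBm : Measurable B)
    (hA : ∀ μ : ∀ i, Measure (U i), (∀ i, IsProbabilityMeasure (μ i)) →
      Integrable A (Measure.pi μ))
    (hB : ∀ μ : ∀ i, Measure (U i), (∀ i, IsProbabilityMeasure (μ i)) →
      Integrable B (Measure.pi μ))
    (hBsign : (∀ u, 0 < B u) ∨ (∀ u, B u < 0))
    (hbdd : BddAbove (Set.range fun u => A u / B u))
    (hnotattain : ∀ u, A u / B u < ⨆ v, A v / B v) :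
    (∀ ε > (0 : ℝ), ∃ u : (i : Fin N) → U i,
      ((⨆ v, A v / B v) - ε < A u / B u ∧ A u / B u < ⨆ v, A v / B v) ∧
      ((⨆ v, A v / B v) - ε <
          (∫ v, A v ∂Measure.pi fun i => Measure.dirac (u i)) /
            (∫ v, B v ∂Measure.pi fun i => Measure.dirac (u i)) ∧
        (∫ v, A v ∂Measure.pi fun i => Measure.dirac (u i)) /
            (∫ v, B v ∂Measure.pi fun i => Measure.dirac (u i)) < ⨆ v, A v / B v)) ∧
    (∀ μ : ∀ i, Measure (U i), (∀ i, IsProbabilityMeasure (μ i)) →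
      (∫ u, A u ∂Measure.pi μ) / (∫ u, B u ∂Measure.pi μ) < ⨆ v, A v / B v) := by
  refine ⟨fun ε hε => ?_, fun μ hμ =>
    integral_div_integral_lt (hA μ hμ) (hB μ hμ) hBsign hnotattain⟩
  obtain ⟨u, hu⟩ := exists_lt_of_lt_ciSup (sub_lt_self (⨆ v, A v / B v) hε)
  refine ⟨u, ⟨hu, hnotattain u⟩, ?_⟩
  rw [pi_dirac_eq_dirac, integral_dirac, integral_dirac]
  exact ⟨hu, hnotattain u⟩
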